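/- Let G be a group acting on a set V, and let K be a collection of nonempty finite subsets of V such that every nonempty subset of a member of K is in K, and g·σ ∈ K for every σ ∈ K and g ∈ G (an invariant abstract simplicial complex on V). Suppose C ∈ K satisfies: (a) for every σ ∈ K there exist g ∈ G and a nonempty subset τ ⊆ C with σ = g·τ; (b) whenever τ, τ′ are nonempty subsets of C and g ∈ G with g·τ = τ′, then τ = τ′. Then: (i) for v, w ∈ C and g ∈ G, g·v = w implies v = w; (ii) the assignment g·Stab_G(v) ↦ g·v is a well-defined injective map from the disjoint union, over v ∈ C, of the left coset spaces G/Stab_G(v), whose image is exactly the set of vertices of K (the elements of V lying in some member of K); (iii) for v₀, …, v_k ∈ C and g₀, …, g_k ∈ G, the left cosets g₀·Stab_G(v₀), …, g_k·Stab_G(v_k) have nonempty common intersection in G if and only if the set {g₀·v₀, …, g_k·v_k} belongs to K. -/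

import Mathlib

open Pointwise

/-- Detecting coset complexes.  Let the group `G` act on the set `V`, and let `K` be a
`G`-invariant abstract simplicial complex on `V` (a collection of nonempty finite subsets of
`V`, closed under nonempty subsets and under the `G`-action).  Suppose `C ∈ K` is a
fundamental maximal simplex: (a) every `σ ∈ K` is a `G`-translate of a nonempty subset of
`C`, and (b) if a `G`-translate of a nonempty subset of `C` is again a nonempty subset of
`C`, the two subsets coincide.  Then:
(i) for `v, w ∈ C`, `g • v = w` implies `v = w`;
(ii) the assignment `g • Stab_G(v) ↦ g • v` is a well-defined injective map from the
disjoint union, over `v ∈ C`, of the coset spaces `G ⧸ Stab_G(v)`, with image exactly the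
set of vertices of `K`;
(iii) cosets `g₀ • Stab_G(v₀), …, g_k • Stab_G(v_k)` (with `vᵢ ∈ C`) intersect nontrivially
iff `{g₀ • v₀, …, g_k • v_k} ∈ K`. -/
theorem detecting_coset_complexes {G V : Type*} [Group G] [MulAction G V] [DecidableEq V]
    (K : Set (Finset V))
    (hne : ∀ σ ∈ K, σ.Nonempty)
    (hdown : ∀ σ ∈ K, ∀ τ : Finset V, τ ⊆ σ → τ.Nonempty → τ ∈ K)
    (hinv : ∀ σ ∈ K, ∀ g : G, σ.image (fun v => g • v) ∈ K)
    (C : Finset V) (hC : C ∈ K)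
    (ha : ∀ σ ∈ K, ∃ g : G, ∃ τ : Finset V, τ ⊆ C ∧ τ.Nonempty ∧
      σ = τ.image (fun v => g • v))
    (hb : ∀ τ τ' : Finset V, τ ⊆ C → τ' ⊆ C → τ.Nonempty → τ'.Nonempty →
      ∀ g : G, τ.image (fun v => g • v) = τ' → τ = τ') :
    -- (i)
    (∀ v ∈ C, ∀ w ∈ C, ∀ g : G, g • v = w → v = w) ∧
    -- (ii)
    (∃ F : ((v : {v : V // v ∈ C}) × (G ⧸ MulAction.stabilizer G (v : V))) → V,
      (∀ (v : {v : V // v ∈ C}) (g : G), F ⟨v, QuotientGroup.mk g⟩ = g • (v : V)) ∧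
      Function.Injective F ∧
      Set.range F = {x : V | ∃ σ ∈ K, x ∈ σ}) ∧
    -- (iii)
    (∀ (k : ℕ) (v : Fin (k + 1) → V), (∀ i, v i ∈ C) → ∀ g : Fin (k + 1) → G,
      ((∃ x : G, ∀ i, x ∈ (g i) • (MulAction.stabilizer G (v i) : Set G)) ↔
        (Finset.univ.image (fun i => g i • v i)) ∈ K)) := by
  have h1 : ∀ v ∈ C, ∀ w ∈ C, ∀ g : G, g • v = w → v = w := by
    intro v hv w hw g h
    have := hb {v} {w} (by simpa using hv) (by simpa using hw) (by simp) (by simp) g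
      (by simp [h])
    simpa using this
  have hmem : ∀ (x g : G) (v : V),
      x ∈ g • (MulAction.stabilizer G v : Set G) ↔ x • v = g • v := by
    intro x g v
    rw [Set.mem_smul_set_iff_inv_smul_mem, SetLike.mem_coe, MulAction.mem_stabilizer_iff,
      smul_eq_mul, mul_smul, inv_smul_eq_iff]
  refine ⟨h1, ⟨fun p => MulAction.ofQuotientStabilizer G (p.1 : V) p.2, ?_, ?_, ?_⟩, ?_⟩
  · intro v g
    rfl
  · rintro ⟨v, p⟩ ⟨w, q⟩ h
    induction p using QuotientGroup.induction_on with | H a => ?_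
    induction q using QuotientGroup.induction_on with | H b => ?_
    have h' : a • (v : V) = b • (w : V) := h
    have hvw : v = w := by
      apply Subtype.ext
      apply h1 v v.2 w w.2 (b⁻¹ * a)
      rw [mul_smul, h', inv_smul_smul]
    subst hvw
    have := MulAction.injective_ofQuotientStabilizer G (v : V) h
    exact congrArg (Sigma.mk v) this
  · ext x
    constructor
    · rintro ⟨⟨v, p⟩, rfl⟩
      induction p using QuotientGroup.induction_on with | H a => ?_
      exact ⟨_, hinv C hC a, Finset.mem_image.2 ⟨v, v.2, rfl⟩⟩
    · rintro ⟨σ, hσ, hx⟩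
      obtain ⟨g, τ, hτ, -, rfl⟩ := ha σ hσ
      obtain ⟨v, hv, rfl⟩ := Finset.mem_image.1 hx
      exact ⟨⟨⟨v, hτ hv⟩, QuotientGroup.mk g⟩, rfl⟩
  · intro k v hv g
    simp only [hmem]
    constructor
    · rintro ⟨x, hx⟩
      refine hdown _ (hinv C hC x) _ ?_ (Finset.univ_nonempty.image _)
      intro y hy
      obtain ⟨i, -, rfl⟩ := Finset.mem_image.1 hy
      exact Finset.mem_image.2 ⟨v i, hv i, hx i⟩
    · intro h
      obtain ⟨x, τ, hτ, -, he⟩ := ha _ h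
      refine ⟨x, fun i => ?_⟩
      have hi : g i • v i ∈ τ.image (fun v => x • v) := by
        rw [← he]
        exact Finset.mem_image.2 ⟨i, Finset.mem_univ _, rfl⟩
      obtain ⟨w, hw, hwi⟩ := Finset.mem_image.1 hi
      have hwi' : x • w = g i • v i := hwi
      have : w = v i := by
        apply h1 w (hτ hw) (v i) (hv i) ((g i)⁻¹ * x)
        rw [mul_smul, hwi', inv_smul_smul]
      rw [← this, hwi', this]
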